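/- arXiv:2308.07115 — 2 statements merged into one kernel-verified Lean document; each statement's English description precedes it below -/
import Mathlib

section
/- Let μ > 0 and 0 < α < 1/2. Then sup_{t ∈ [0, √(2μ))} ∫_{−√(2μ)}^{√(2μ)} ( 1 + |μ − (|p| + t)²|^{−1/2−α} ) dp < ∞; in particular, for each such t the integrand is integrable on (−√(2μ), √(2μ)). -/
open MeasureTheory Real

/-- The singularity `|x| ^ (-β)` with `β < 1` is integrable on bounded symmetric intervals. -/
theorem lintegral_Ioo_ofReal_abs_rpow_neg_lt_top {β : ℝ} (hβ : β < 1) (M : ℝ) :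
    ∫⁻ x in Set.Ioo (-M) M, ENNReal.ofReal |x| ^ (-β) < ⊤ := by
  have hf : IntegrableOn (fun x : ℝ => x ^ (-β)) (Set.Ioo 0 M) := by
    rcases le_or_gt M 0 with hM | hM
    · simp [Set.Ioo_eq_empty_of_le hM]
    · exact (intervalIntegral.integrableOn_Ioo_rpow_iff hM).2 (by linarith)
  have hball : IntegrableOn (fun x : ℝ => |x| ^ (-β)) (Set.Ioo (-M) M) := by
    have h := (integrableOn_fun_norm_addHaar (E := ℝ) volume (f := fun y => y ^ (-β)) (r := M)).2
      (by simpa using hf)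
    simpa [Real.ball_eq_Ioo] using h
  refine lt_of_le_of_lt (lintegral_mono_ae ?_) hball.lintegral_lt_top
  filter_upwards [ae_restrict_of_ae (Measure.ae_ne volume (0 : ℝ))] with x hx
  rw [ENNReal.ofReal_rpow_of_pos (abs_pos.2 hx)]

/-- Integrating a translate by at most `R` over `(-R, R)` costs at most the integral
over `(-2R, 2R)`. -/
theorem setLIntegral_Ioo_comp_add_le {g : ℝ → ENNReal} {R c : ℝ} (hc : |c| ≤ R) :
    ∫⁻ p in Set.Ioo (-R) R, g (p + c) ≤ ∫⁻ x in Set.Ioo (-(2 * R)) (2 * R), g x := by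
  rw [← lintegral_indicator measurableSet_Ioo, ← lintegral_indicator measurableSet_Ioo,
    ← lintegral_add_right_eq_self ((Set.Ioo (-(2 * R)) (2 * R)).indicator g) c]
  refine lintegral_mono fun p => ?_
  obtain ⟨h1, h2⟩ := abs_le.1 hc
  by_cases hp : p ∈ Set.Ioo (-R) R
  · have hpc : p + c ∈ Set.Ioo (-(2 * R)) (2 * R) :=
      ⟨by linarith [hp.1], by linarith [hp.2]⟩
    rw [Set.indicator_of_mem hp, Set.indicator_of_mem hpc]
  · rw [Set.indicator_of_notMem hp]
    exact zero_le

/-- Near `(|p| + t)² = μ` the kernel is dominated by two translates of `|x| ^ (-β)`. -/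
theorem ofReal_abs_sub_sq_rpow_neg_le {μ β t : ℝ} (hμ : 0 < μ) (hβ : 0 ≤ β) (ht : 0 ≤ t)
    (p : ℝ) :
    ENNReal.ofReal |μ - (|p| + t) ^ 2| ^ (-β) ≤ ENNReal.ofReal √μ ^ (-β) *
      (ENNReal.ofReal |p + (t - √μ)| ^ (-β) + ENNReal.ofReal |p + (√μ - t)| ^ (-β)) := by
  have hs : 0 < √μ := Real.sqrt_pos.2 hμ
  have hlow : √μ * |(|p| + (t - √μ))| ≤ |μ - (|p| + t) ^ 2| := by
    have h : μ - (|p| + t) ^ 2 = -((√μ + (|p| + t)) * (|p| + (t - √μ))) := by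
      nlinarith [Real.sq_sqrt hμ.le]
    rw [h, abs_neg, abs_mul, abs_of_pos (by positivity : 0 < √μ + (|p| + t))]
    gcongr
    linarith [abs_nonneg p]
  calc ENNReal.ofReal |μ - (|p| + t) ^ 2| ^ (-β)
      ≤ ENNReal.ofReal (√μ * |(|p| + (t - √μ))|) ^ (-β) := by
        rw [ENNReal.rpow_neg, ENNReal.rpow_neg]
        gcongr
    _ = ENNReal.ofReal √μ ^ (-β) * ENNReal.ofReal |(|p| + (t - √μ))| ^ (-β) := by
        rw [ENNReal.ofReal_mul hs.le, ENNReal.mul_rpow_of_ne_top ENNReal.ofReal_ne_top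
          ENNReal.ofReal_ne_top]
    _ ≤ _ := by
        gcongr
        rcases abs_choice p with h | h <;> rw [h]
        · exact le_self_add
        · rw [show -p + (t - √μ) = -(p + (√μ - t)) by ring, abs_neg]
          exact le_add_self

/-- `sup_{t ∈ [0,√(2μ))} ∫_{−√(2μ)}^{√(2μ)} (1 + |μ − (|p|+t)²|^{−1/2−α}) dp < ∞`,
where the integrand is interpreted as an extended-real-valued function (equal to `+∞`
on the measure-zero set where `μ = (|p|+t)²`, via the convention `0^y = ∞` for `y < 0`
in `ℝ≥0∞`). -/
theorem schur_test_integral_finite (μ α : ℝ) (hμ : 0 < μ) (hα0 : 0 < α) (hα : α < 1 / 2) :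
    (⨆ t ∈ Set.Ico (0 : ℝ) (Real.sqrt (2 * μ)),
      ∫⁻ p in Set.Ioo (-Real.sqrt (2 * μ)) (Real.sqrt (2 * μ)),
        (1 + (ENNReal.ofReal |μ - (|p| + t) ^ 2|) ^ (-(1 / 2 + α) : ℝ))) < ⊤ := by
  set R := √(2 * μ)
  set β := 1 / 2 + α with hβ
  set g : ℝ → ENNReal := fun x => ENNReal.ofReal |x| ^ (-β)
  set K := ∫⁻ x in Set.Ioo (-(2 * R)) (2 * R), g x
  have hK : K < ⊤ := lintegral_Ioo_ofReal_abs_rpow_neg_lt_top (by linarith) _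
  have hC : ENNReal.ofReal √μ ^ (-β) < ⊤ := by
    rw [ENNReal.ofReal_rpow_of_pos (Real.sqrt_pos.2 hμ)]
    exact ENNReal.ofReal_lt_top
  have hsR : √μ ≤ R := Real.sqrt_le_sqrt (by linarith)
  have hg : Measurable g := by fun_prop
  have hbound : volume (Set.Ioo (-R) R) + ENNReal.ofReal √μ ^ (-β) * (K + K) < ⊤ :=
    ENNReal.add_lt_top.2 ⟨by simp, ENNReal.mul_lt_top hC (ENNReal.add_lt_top.2 ⟨hK, hK⟩)⟩
  refine lt_of_le_of_lt (iSup₂_le fun t ht => ?_) hbound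
  have hc : |t - √μ| ≤ R :=
    abs_le.2 ⟨by linarith [ht.1], by linarith [ht.2, Real.sqrt_nonneg μ]⟩
  calc ∫⁻ p in Set.Ioo (-R) R, (1 + ENNReal.ofReal |μ - (|p| + t) ^ 2| ^ (-β))
      ≤ ∫⁻ p in Set.Ioo (-R) R,
          (1 + ENNReal.ofReal √μ ^ (-β) * (g (p + (t - √μ)) + g (p + (√μ - t)))) := by
        refine lintegral_mono fun p => ?_
        gcongr
        exact ofReal_abs_sub_sq_rpow_neg_le hμ (by linarith) ht.1 p
    _ = volume (Set.Ioo (-R) R) + ENNReal.ofReal √μ ^ (-β) *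
          ((∫⁻ p in Set.Ioo (-R) R, g (p + (t - √μ))) +
            ∫⁻ p in Set.Ioo (-R) R, g (p + (√μ - t))) := by
        rw [lintegral_add_left measurable_const, lintegral_const_mul _ (by fun_prop),
          lintegral_add_left (by fun_prop)]
        simp
    _ ≤ _ := by
        gcongr
        · exact setLIntegral_Ioo_comp_add_le hc
        · exact setLIntegral_Ioo_comp_add_le (by rwa [abs_sub_comm])
end

section
/- Let μ > 0 and let V ∈ L¹(ℝ²) be radial. Define j₂ : ℝ² → ℝ by j₂(r) = (1/(2π)) ∫_{S¹} e^{i √μ ω·r} dω, where the integral is over the unit circle S¹ ⊂ ℝ² with its one-dimensional Hausdorff (arclength) measure. Then for every p ∈ ℝ² with |p| = √μ, (1/(2π)) ∫_{ℝ²} e^{−i p·r} V(r) j₂(r) dr = (1/(2π)) ∫_{ℝ²} V(r) j₂(r)² dr. (Both integrals converge absolutely since |j₂| ≤ 1 and V ∈ L¹.) -/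
open MeasureTheory Real

/-- `j₂(r) = (1/(2π)) ∫_{S¹} e^{i √μ ω·r} dω`, written out via the arclength
parametrization `ω = (cos θ, sin θ)` of the unit circle (the imaginary part
integrates to zero, so `j₂` is real-valued). -/
noncomputable def jtwo (μ : ℝ) (r : ℝ × ℝ) : ℝ :=
  (1 / (2 * Real.pi)) *
    ∫ θ in (0 : ℝ)..(2 * Real.pi),
      Real.cos (Real.sqrt μ * (r.1 * Real.cos θ + r.2 * Real.sin θ))

/-- Rotation of the plane by the angle `a`, as a measurable equivalence. -/
noncomputable def planeRotation (a : ℝ) : ℝ × ℝ ≃ᵐ ℝ × ℝ :=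
  (Complex.measurableEquivRealProd.symm.trans
    (rotation (Circle.exp a)).toHomeomorph.toMeasurableEquiv).trans Complex.measurableEquivRealProd

theorem planeRotation_apply (a : ℝ) (r : ℝ × ℝ) :
    planeRotation a r =
      (Real.cos a * r.1 - Real.sin a * r.2, Real.cos a * r.2 + Real.sin a * r.1) := by
  have h : planeRotation a r =
      Complex.measurableEquivRealProd (Complex.exp (a * Complex.I) * ⟨r.1, r.2⟩) := rfl
  rw [h, Complex.measurableEquivRealProd_apply]
  simp [Complex.exp_ofReal_mul_I_re, Complex.exp_ofReal_mul_I_im]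

theorem measurePreserving_planeRotation (a : ℝ) : MeasurePreserving (planeRotation a) :=
  (Complex.volume_preserving_equiv_real_prod.symm.trans
    (rotation (Circle.exp a)).measurePreserving).trans Complex.volume_preserving_equiv_real_prod

/-- The integral defining `jtwo` may start at any angle. -/
theorem integral_cos_circle_shift (s x y a : ℝ) :
    ∫ θ in (0 : ℝ)..(2 * π), Real.cos (s * (x * Real.cos (θ + a) + y * Real.sin (θ + a))) =
      ∫ θ in (0 : ℝ)..(2 * π), Real.cos (s * (x * Real.cos θ + y * Real.sin θ)) := by
  have hper : Function.Periodic
      (fun θ => Real.cos (s * (x * Real.cos θ + y * Real.sin θ))) (2 * π) := by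
    intro θ
    simp
  rw [intervalIntegral.integral_comp_add_right
    (fun θ => Real.cos (s * (x * Real.cos θ + y * Real.sin θ)))]
  have h := hper.intervalIntegral_add_eq a 0
  simpa [add_comm] using h

theorem jtwo_planeRotation (μ a : ℝ) (r : ℝ × ℝ) : jtwo μ (planeRotation a r) = jtwo μ r := by
  unfold jtwo
  rw [← integral_cos_circle_shift _ r.1 r.2 (-a), planeRotation_apply]
  congr 2
  ext θ
  rw [Real.cos_add θ, Real.sin_add θ, Real.cos_neg a, Real.sin_neg a]
  ring_nf

theorem jtwo_neg (μ : ℝ) (r : ℝ × ℝ) : jtwo μ (-r) = jtwo μ r := by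
  unfold jtwo
  congr 2
  ext θ
  rw [← Real.cos_neg]
  congr 1
  simp only [Prod.fst_neg, Prod.snd_neg]
  ring

theorem continuous_jtwo (μ : ℝ) : Continuous (jtwo μ) := by
  unfold jtwo
  refine continuous_const.mul ?_
  refine intervalIntegral.continuous_parametric_intervalIntegral_of_continuous' ?_ _ _
  unfold Function.uncurry
  fun_prop

theorem abs_jtwo_le_one (μ : ℝ) (r : ℝ × ℝ) : |jtwo μ r| ≤ 1 := by
  have hpi : (0 : ℝ) < 2 * π := by positivity
  have h := intervalIntegral.norm_integral_le_of_norm_le_const (a := 0) (b := 2 * π) (C := 1)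
    (f := fun θ => Real.cos (√μ * (r.1 * Real.cos θ + r.2 * Real.sin θ)))
    (fun θ _ => Real.abs_cos_le_one _)
  rw [sub_zero, abs_of_pos hpi, one_mul, Real.norm_eq_abs] at h
  unfold jtwo
  rw [abs_mul, abs_of_pos (by positivity : 0 < 1 / (2 * π)), one_div, inv_mul_le_iff₀ hpi, mul_one]
  exact h

theorem exists_angle {μ : ℝ} {p : ℝ × ℝ} (hp : p.1 ^ 2 + p.2 ^ 2 = μ) :
    ∃ a : ℝ, p = (√μ * Real.cos a, √μ * Real.sin a) := by
  have hnorm : ‖(⟨p.1, p.2⟩ : ℂ)‖ = √μ := by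
    rw [Complex.norm_def, Complex.normSq_mk, ← hp]
    ring_nf
  refine ⟨Complex.arg ⟨p.1, p.2⟩, ?_⟩
  rw [← hnorm, Complex.norm_mul_cos_arg, Complex.norm_mul_sin_arg]

/-- For a rotation-invariant integrable function, the cosine transform on the circle of radius
`√μ` is the integral against `jtwo μ`. -/
theorem integral_cos_mul_eq_integral_jtwo_mul {μ : ℝ} {g : ℝ × ℝ → ℝ} (hg : Integrable g)
    (hrot : ∀ a r, g (planeRotation a r) = g r) {p : ℝ × ℝ} (hp : p.1 ^ 2 + p.2 ^ 2 = μ) :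
    ∫ r, Real.cos (p.1 * r.1 + p.2 * r.2) * g r = ∫ r, jtwo μ r * g r := by
  obtain ⟨a, rfl⟩ := exists_angle hp
  set c := ∫ r : ℝ × ℝ, Real.cos (√μ * Real.cos a * r.1 + √μ * Real.sin a * r.2) * g r with hc
  have hconst : ∀ θ : ℝ,
      ∫ r : ℝ × ℝ, Real.cos (√μ * (r.1 * Real.cos θ + r.2 * Real.sin θ)) * g r = c := by
    intro θ
    rw [hc, ← (measurePreserving_planeRotation (θ - a)).integral_comp']
    congr 1
    ext r
    rw [hrot, planeRotation_apply]
    congr 2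
    have h1 : Real.cos a = Real.cos (θ - (θ - a)) := by rw [sub_sub_cancel]
    have h2 : Real.sin a = Real.sin (θ - (θ - a)) := by rw [sub_sub_cancel]
    rw [h1, h2, Real.cos_sub θ (θ - a), Real.sin_sub θ (θ - a)]
    ring
  have hint : Integrable (Function.uncurry fun (θ : ℝ) (r : ℝ × ℝ) =>
      Real.cos (√μ * (r.1 * Real.cos θ + r.2 * Real.sin θ)) * g r)
      ((volume.restrict (Set.uIoc 0 (2 * π))).prod volume) := by
    have : IsFiniteMeasure (volume.restrict (Set.uIoc 0 (2 * π))) := by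
      rw [Set.uIoc]
      infer_instance
    have hg' : Integrable (fun z : ℝ × (ℝ × ℝ) => g z.2)
        ((volume.restrict (Set.uIoc 0 (2 * π))).prod volume) := hg.comp_snd _
    refine hg'.bdd_mul (c := 1) ?_ (Filter.Eventually.of_forall fun z => Real.abs_cos_le_one _)
    exact Continuous.aestronglyMeasurable (by fun_prop)
  have hswap := intervalIntegral_integral_swap hint
  simp only [hconst, intervalIntegral.integral_const, intervalIntegral.integral_mul_const,
    sub_zero, smul_eq_mul] at hswap
  have hpi : (2 * π) ≠ 0 := by positivity
  calc c = 1 / (2 * π) * (2 * π * c) := by field_simp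
    _ = ∫ r, jtwo μ r * g r := by
      rw [hswap, ← integral_const_mul]
      simp only [jtwo, mul_assoc]

/-- The exponential transform of an even integrable real function is its cosine transform. -/
theorem integral_exp_mul_even {g : ℝ × ℝ → ℝ} (hg : Integrable g) (heven : ∀ r, g (-r) = g r)
    (p : ℝ × ℝ) :
    ∫ r : ℝ × ℝ, Complex.exp (-Complex.I * ((p.1 * r.1 + p.2 * r.2 : ℝ) : ℂ)) * (g r : ℂ) =
      ((∫ r : ℝ × ℝ, Real.cos (p.1 * r.1 + p.2 * r.2) * g r : ℝ) : ℂ) := by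
  have hcos : Integrable fun r : ℝ × ℝ => Real.cos (p.1 * r.1 + p.2 * r.2) * g r :=
    hg.bdd_mul (c := 1) (Continuous.aestronglyMeasurable (by fun_prop))
      (Filter.Eventually.of_forall fun r => Real.abs_cos_le_one _)
  have hsin : Integrable fun r : ℝ × ℝ => Real.sin (p.1 * r.1 + p.2 * r.2) * g r :=
    hg.bdd_mul (c := 1) (Continuous.aestronglyMeasurable (by fun_prop))
      (Filter.Eventually.of_forall fun r => Real.abs_sin_le_one _)
  have hzero : ∫ r : ℝ × ℝ, Real.sin (p.1 * r.1 + p.2 * r.2) * g r = 0 := by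
    have h := integral_neg_eq_self
      (fun r : ℝ × ℝ => Real.sin (p.1 * r.1 + p.2 * r.2) * g r) volume
    have hodd : ∀ r : ℝ × ℝ, Real.sin (p.1 * (-r).1 + p.2 * (-r).2) * g (-r) =
        -(Real.sin (p.1 * r.1 + p.2 * r.2) * g r) := by
      intro r
      rw [heven, ← neg_mul, ← Real.sin_neg]
      congr 2
      simp only [Prod.fst_neg, Prod.snd_neg]
      ring
    simp only [hodd, integral_neg] at h
    linarith
  have hsplit : ∀ r : ℝ × ℝ,
      Complex.exp (-Complex.I * ((p.1 * r.1 + p.2 * r.2 : ℝ) : ℂ)) * (g r : ℂ) =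
      ((Real.cos (p.1 * r.1 + p.2 * r.2) * g r : ℝ) : ℂ) -
        Complex.I * ((Real.sin (p.1 * r.1 + p.2 * r.2) * g r : ℝ) : ℂ) := by
    intro r
    generalize p.1 * r.1 + p.2 * r.2 = x
    rw [show -Complex.I * (x : ℂ) = (-x : ℂ) * Complex.I by ring, Complex.exp_mul_I,
      Complex.cos_neg, Complex.sin_neg]
    push_cast
    ring
  simp only [hsplit]
  rw [integral_sub hcos.ofReal (hsin.ofReal.const_mul _), integral_const_mul,
    integral_complex_ofReal, integral_complex_ofReal, hzero]
  simp

/-- For radial integrable `V` and any `p` on the circle `|p| = √μ`, the Fourier transform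
of `V j₂` at `p` equals the constant `(1/(2π)) ∫ V j₂²`. -/
theorem fourier_Vj_on_sphere (μ : ℝ) (hμ : 0 < μ) (V : ℝ × ℝ → ℝ) (hV1 : Integrable V)
    (hrad : ∀ r r' : ℝ × ℝ, r.1 ^ 2 + r.2 ^ 2 = r'.1 ^ 2 + r'.2 ^ 2 → V r = V r')
    (p : ℝ × ℝ) (hp : p.1 ^ 2 + p.2 ^ 2 = μ) :
    ((1 / (2 * Real.pi) : ℝ) : ℂ) *
        ∫ r : ℝ × ℝ, Complex.exp (-Complex.I * ((p.1 * r.1 + p.2 * r.2 : ℝ) : ℂ)) *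
          (V r : ℂ) * (jtwo μ r : ℂ) =
      (((1 / (2 * Real.pi)) * ∫ r : ℝ × ℝ, V r * (jtwo μ r) ^ 2 : ℝ) : ℂ) := by
  have hg : Integrable fun r => V r * jtwo μ r :=
    hV1.mul_bdd (c := 1) (continuous_jtwo μ).aestronglyMeasurable
      (Filter.Eventually.of_forall (abs_jtwo_le_one μ))
  have hrot : ∀ a r, V (planeRotation a r) * jtwo μ (planeRotation a r) = V r * jtwo μ r := by
    intro a r
    rw [jtwo_planeRotation, hrad (planeRotation a r) r]
    rw [planeRotation_apply]
    linear_combination (r.1 ^ 2 + r.2 ^ 2) * Real.sin_sq_add_cos_sq a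
  have heven : ∀ r, V (-r) * jtwo μ (-r) = V r * jtwo μ r := by
    intro r
    rw [jtwo_neg, hrad (-r) r (by simp)]
  have hexp := integral_exp_mul_even hg heven p
  rw [integral_cos_mul_eq_integral_jtwo_mul hg hrot hp] at hexp
  simp only [Complex.ofReal_mul, ← mul_assoc] at hexp
  rw [Complex.ofReal_mul, hexp]
  congr 3
  ext r
  ring
end
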